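/- arXiv:2301.06157 — 2 statements merged into one kernel-verified Lean document; each statement's English description precedes it below -/
import Mathlib

section
/- Let G be a mean-payoff game and ρ a run in G. There exists a strategy profile σ in the core of G with ρ = ρ(σ) if and only if for every coalition C ⊆ Ag and every lower bound z_C ∈ ℚ^C for C, there is some i ∈ C with z_i ≤ pay_i(ρ). -/
/-- A concurrent game structure over a set of agents `Ag`, states `St`, and,
for each agent `i`, a set of actions `Ac i`.  It consists of an initial state
and a transition function. -/
structure CGS (Ag St : Type) (Ac : Ag → Type) where
  init : St
  tr : St → (∀ i, Ac i) → St

/-- A strategy for a player with actions `A`: it maps finite (nonempty)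
histories of states, given as lists, to an action. -/
abbrev Strategy (St A : Type) := List St → A

/-- A strategy profile: one strategy for each player. -/
abbrev Profile {Ag : Type} (St : Type) (Ac : Ag → Type) := ∀ i, Strategy St (Ac i)

namespace CGS

variable {Ag St : Type} {Ac : Ag → Type}

/-- The history `ρ(σ)[0 … t]` (as a list) together with the current state
`ρ(σ)[t]` of the run induced by a strategy profile `σ`. -/
def histRun (M : CGS Ag St Ac) (σ : Profile St Ac) : ℕ → List St × St
  | 0 => ([M.init], M.init)
  | t + 1 =>
      let p := histRun M σ t
      let s := M.tr p.2 (fun i => σ i p.1)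
      (p.1 ++ [s], s)

/-- The unique run `ρ(σ)` induced by a strategy profile `σ`. -/
def run (M : CGS Ag St Ac) (σ : Profile St Ac) (t : ℕ) : St :=
  (histRun M σ t).2

/-- A run of `M`: an infinite state sequence starting at the initial state in
which every step is obtained by some action profile. -/
def IsRun (M : CGS Ag St Ac) (ρ : ℕ → St) : Prop :=
  ρ 0 = M.init ∧ ∀ t, ∃ a : ∀ i, Ac i, ρ (t + 1) = M.tr (ρ t) a

end CGS

open Classical in
/-- Combine a joint strategy `σC` for a coalition `C` with strategies `σN`
for the players outside `C`, obtaining a full strategy profile. -/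
noncomputable def combine {Ag St : Type} {Ac : Ag → Type} (C : Set Ag)
    (σC : ∀ i ∈ C, Strategy St (Ac i)) (σN : ∀ i ∉ C, Strategy St (Ac i)) :
    Profile St Ac :=
  fun i => if h : i ∈ C then σC i h else σN i h

/-- A mean-payoff game: a concurrent game structure together with an integer
weight function on states for each player. -/
structure MPGame (Ag St : Type) (Ac : Ag → Type) where
  M : CGS Ag St Ac
  w : Ag → St → ℤ

/-- The mean-payoff of an infinite sequence of reals:
`liminf_{n→∞} (1/n) Σ_{t<n} β t`. -/
noncomputable def meanPayoff (β : ℕ → ℝ) : ℝ :=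
  Filter.liminf (fun n : ℕ => (∑ t ∈ Finset.range n, β t) / (n : ℝ)) Filter.atTop

namespace MPGame

variable {Ag St : Type} {Ac : Ag → Type}

/-- The payoff of player `i` on the run `ρ`: the mean-payoff of the induced
sequence of weights. -/
noncomputable def pay (G : MPGame Ag St Ac) (i : Ag) (ρ : ℕ → St) : ℝ :=
  meanPayoff fun t => (G.w i (ρ t) : ℝ)

/-- `σC` is a beneficial deviation for the (nonempty) coalition `C` from `σ`:
for every joint strategy `σN` of the other players, every member of `C` gets
a strictly larger payoff under `(σC, σN)` than under `σ`. -/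
def BeneficialDeviation (G : MPGame Ag St Ac) (C : Set Ag)
    (σ : Profile St Ac) (σC : ∀ i ∈ C, Strategy St (Ac i)) : Prop :=
  C.Nonempty ∧
  ∀ σN : ∀ i ∉ C, Strategy St (Ac i), ∀ i ∈ C,
    G.pay i (G.M.run (combine C σC σN)) > G.pay i (G.M.run σ)

/-- A strategy profile is in the core iff no coalition has a beneficial
deviation from it. -/
def inCore (G : MPGame Ag St Ac) (σ : Profile St Ac) : Prop :=
  ∀ (C : Set Ag) (σC : ∀ i ∈ C, Strategy St (Ac i)),
    ¬ G.BeneficialDeviation C σ σC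

/-- `z` is a lower bound for the coalition `C`: `C` has a joint strategy that
guarantees each member `i ∈ C` a payoff of at least `z i`, against every
joint strategy of the remaining players. -/
def IsLowerBound (G : MPGame Ag St Ac) (C : Set Ag) (z : Ag → ℚ) : Prop :=
  ∃ σC : ∀ i ∈ C, Strategy St (Ac i),
    ∀ σN : ∀ i ∉ C, Strategy St (Ac i), ∀ i ∈ C,
      (z i : ℝ) ≤ G.pay i (G.M.run (combine C σC σN))

end MPGame

/-- The strategy corresponding to a memoryless strategy `f : St → A`: at any
history it plays the action assigned to the current (last) state.  (`s0` is a
default value, irrelevant since histories are nonempty.) -/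
def memorylessLift {St A : Type} (s0 : St) (f : St → A) : Strategy St A :=
  fun h => f (h.getLastD s0)

/-- A strategy with memory for the player who picks vertices in `V`, against an opponent who
answers with a state in `S`.  The memory positions are labelled by the vertex being played. -/
structure Plan {V S : Type} (π : V → S) where
  Pos : Type
  lab : Pos → V
  next : Pos → S → Pos
  proj : ∀ p x, π (lab (next p x)) = x

namespace Plan

variable {V S I : Type} {π : V → S}

/-- `f` is a play of the plan against an opponent restricted to the moves in `R`; the play
stutters at the times where `mv` is false. -/
def IsPlay (P : Plan π) (R : V → Finset S) (f : ℕ → P.Pos) (mv : ℕ → Bool) : Prop :=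
  ∀ t, (mv t = true → ∃ x ∈ R (P.lab (f t)), f (t + 1) = P.next (f t) x) ∧
    (mv t = false → f (t + 1) = f t)

/-- The contribution of the first `T` steps of a stuttering play to the sum of the weights,
each raised by `ε`. -/
def total (P : Plan π) (g : S → ℝ) (ε : ℝ) (f : ℕ → P.Pos) (mv : ℕ → Bool) (T : ℕ) : ℝ :=
  ∑ t ∈ Finset.range T, if mv t = true then g (π (P.lab (f (t + 1)))) + ε else 0

/-- From the position `p`, the plan guarantees a nonnegative lower mean of every weight. -/
def WinsFrom (P : Plan π) (u : I → S → ℝ) (R : V → Finset S) (p : P.Pos) : Prop :=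
  ∀ f mv, P.IsPlay R f mv → f 0 = p → ∀ i, ∀ ε > 0, ∃ K : ℝ, ∀ T, -K ≤ P.total (u i) ε f mv T

theorem WinsFrom.next {P : Plan π} {u : I → S → ℝ} {R : V → Finset S} {p : P.Pos}
    (h : P.WinsFrom u R p) {x : S} (hx : x ∈ R (P.lab p)) :
    P.WinsFrom u R (P.next p x) := by
  intro f mv hf h0 i ε hε
  obtain ⟨K, hK⟩ := h (fun t => Nat.casesOn t p f) (fun t => Nat.casesOn t true mv)
    (by
      rintro (_ | t)
      · exact ⟨fun _ => ⟨x, hx, h0⟩, fun hc => by simp at hc⟩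
      · exact hf t) rfl i ε hε
  refine ⟨K + (u i (π (P.lab (f 0))) + ε), fun T => ?_⟩
  have := hK (T + 1)
  simp only [total, Finset.sum_range_succ'] at this ⊢
  have h1 : (Nat.casesOn 0 true mv : Bool) = true := rfl
  rw [if_pos h1] at this
  linarith

/-- A winning plan that cannot reach a vertex stays winning when moves are added there. -/
theorem WinsFrom.of_avoids [DecidableEq V] {P : Plan π} {u : I → S → ℝ} {R : V → Finset S}
    {q : V} {E : Finset S} {p : P.Pos} (h : P.WinsFrom u (Function.update R q E) p)
    (hq : ∀ p, P.WinsFrom u (Function.update R q E) p → P.lab p ≠ q) :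
    P.WinsFrom u R p := by
  intro f mv hf h0
  have hw : ∀ t, P.WinsFrom u (Function.update R q E) (f t) := by
    intro t
    induction t with
    | zero => rwa [h0]
    | succ t ih =>
      cases hm : mv t with
      | false => rwa [(hf t).2 hm]
      | true =>
        obtain ⟨x, hx, he⟩ := (hf t).1 hm
        rw [he]
        exact ih.next (by rwa [Function.update_of_ne (hq _ ih)])
  refine h f mv (fun t => ⟨fun hm => ?_, (hf t).2⟩) h0
  rw [Function.update_of_ne (hq _ (hw t))]
  exact (hf t).1 hm

open Classical in
/-- Follow `P₁` or `P₂`, switching at the vertex `q` according to whether the opponent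
answers with `x₀`. -/
noncomputable def merge (P₁ P₂ : Plan π) (q : V) (x₀ : S) : Plan π where
  Pos := P₁.Pos × P₂.Pos × Bool
  lab c := if c.2.2 = true then P₁.lab c.1 else P₂.lab c.2.1
  next c x :=
    if (if (if c.2.2 = true then P₁.lab c.1 else P₂.lab c.2.1) = q then decide (x = x₀)
      else c.2.2) = true
    then (P₁.next c.1 x, c.2.1, true) else (c.1, P₂.next c.2.1 x, false)
  proj c x := by
    split_ifs <;> simp_all [P₁.proj, P₂.proj]

open Classical in
theorem merge_step (P₁ P₂ : Plan π) (q : V) (x₀ : S) (R : V → Finset S)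
    (p₁ : P₁.Pos) (p₂ : P₂.Pos) (m : Bool)
    (h₁ : m = true → P₂.lab p₂ = q) (h₂ : m = false → P₁.lab p₁ = q)
    (x : S) (hx : x ∈ R ((merge P₁ P₂ q x₀).lab (p₁, p₂, m))) :
    ((merge P₁ P₂ q x₀).next (p₁, p₂, m) x = (P₁.next p₁ x, p₂, true) ∧
      x ∈ Function.update R q {x₀} (P₁.lab p₁) ∧ P₂.lab p₂ = q) ∨
    ((merge P₁ P₂ q x₀).next (p₁, p₂, m) x = (p₁, P₂.next p₂ x, false) ∧
      x ∈ Function.update R q ((R q).erase x₀) (P₂.lab p₂) ∧ P₁.lab p₁ = q) := by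
  cases m
  · have h₂ := h₂ rfl
    by_cases hq : P₂.lab p₂ = q <;> by_cases hxx : x = x₀ <;>
      simp_all [merge]
  · have h₁ := h₁ rfl
    by_cases hq : P₁.lab p₁ = q <;> by_cases hxx : x = x₀ <;>
      simp_all [merge]

open Classical in
theorem WinsFrom.merge {P₁ P₂ : Plan π} {u : I → S → ℝ} {R : V → Finset S} {q : V} {x₀ : S}
    {p₁ : P₁.Pos} {p₂ : P₂.Pos}
    (h₁ : P₁.WinsFrom u (Function.update R q {x₀}) p₁)
    (h₂ : P₂.WinsFrom u (Function.update R q ((R q).erase x₀)) p₂) (hq : P₂.lab p₂ = q) :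
    (merge P₁ P₂ q x₀).WinsFrom u R (p₁, p₂, true) := by
  intro f mv hf h0 i ε hε
  have inv : ∀ t, ((f t).2.2 = true → P₂.lab (f t).2.1 = q) ∧
      ((f t).2.2 = false → P₁.lab (f t).1 = q) := by
    intro t
    induction t with
    | zero => rw [h0]; simp [hq]
    | succ t ih =>
      cases hm : mv t with
      | false => rwa [(hf t).2 hm]
      | true =>
        obtain ⟨x, hx, he⟩ := (hf t).1 hm
        rw [he]
        rcases merge_step P₁ P₂ q x₀ R (f t).1 (f t).2.1 (f t).2.2 ih.1 ih.2 x hx with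
          ⟨e, -, hl⟩ | ⟨e, -, hl⟩
        · erw [e]; simp [hl]
        · erw [e]; simp [hl]
  have step : ∀ t, mv t = true →
      ((f (t + 1)).2.2 = true ∧ (∃ x ∈ Function.update R q {x₀} (P₁.lab (f t).1),
        (f (t + 1)).1 = P₁.next (f t).1 x) ∧ (f (t + 1)).2.1 = (f t).2.1) ∨
      ((f (t + 1)).2.2 = false ∧ (∃ x ∈ Function.update R q ((R q).erase x₀) (P₂.lab (f t).2.1),
        (f (t + 1)).2.1 = P₂.next (f t).2.1 x) ∧ (f (t + 1)).1 = (f t).1) := by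
    intro t hm
    obtain ⟨x, hx, he⟩ := (hf t).1 hm
    rcases merge_step P₁ P₂ q x₀ R (f t).1 (f t).2.1 (f t).2.2 (inv t).1 (inv t).2 x hx with
      ⟨e, hl, -⟩ | ⟨e, hl, -⟩
    · have := he.trans e
      exact Or.inl ⟨by rw [this], ⟨x, hl, by rw [this]⟩, by rw [this]⟩
    · have := he.trans e
      exact Or.inr ⟨by rw [this], ⟨x, hl, by rw [this]⟩, by rw [this]⟩
  obtain ⟨K₁, hK₁⟩ := h₁ (fun t => (f t).1) (fun t => mv t && (f (t + 1)).2.2)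
    (by
      intro t
      cases hm : mv t with
      | false => simp [hm, (hf t).2 hm]
      | true => rcases step t hm with ⟨a, b, c⟩ | ⟨a, b, c⟩ <;> simp_all)
    (by simp [h0]) i ε hε
  obtain ⟨K₂, hK₂⟩ := h₂ (fun t => (f t).2.1) (fun t => mv t && !(f (t + 1)).2.2)
    (by
      intro t
      cases hm : mv t with
      | false => simp [hm, (hf t).2 hm]
      | true => rcases step t hm with ⟨a, b, c⟩ | ⟨a, b, c⟩ <;> simp_all)
    (by simp [h0]) i ε hε
  refine ⟨K₁ + K₂, fun T => ?_⟩
  have key : (Plan.merge P₁ P₂ q x₀).total (u i) ε f mv T =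
      P₁.total (u i) ε (fun t => (f t).1) (fun t => mv t && (f (t + 1)).2.2) T +
      P₂.total (u i) ε (fun t => (f t).2.1) (fun t => mv t && !(f (t + 1)).2.2) T := by
    simp only [total, ← Finset.sum_add_distrib]
    refine Finset.sum_congr rfl fun t _ => ?_
    cases hm : mv t <;> cases hb : (f (t + 1)).2.2 <;> simp [Plan.merge, hb]
  rw [key]
  linarith [hK₁ T, hK₂ T]

open Classical in
/-- The plan that follows a fixed path `g` as long as the opponent does so. -/
noncomputable def ofPath (hπ : Function.Surjective π) (g : ℕ → V) : Plan π where
  Pos := ℕ × V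
  lab := Prod.snd
  next p x := (p.1 + 1, if π (g (p.1 + 1)) = x then g (p.1 + 1) else (hπ x).choose)
  proj p x := by
    dsimp only
    split_ifs with h
    · exact h
    · exact (hπ x).choose_spec

theorem winsFrom_ofPath (hπ : Function.Surjective π) {g : ℕ → V} {R : V → Finset S}
    (hg : ∀ t, ∀ x ∈ R (g t), x = π (g (t + 1))) {u : I → S → ℝ}
    (hu : ∀ i, ∀ ε > 0, ∃ K : ℝ, ∀ T, -K ≤ ∑ t ∈ Finset.range T, (u i (π (g (t + 1))) + ε)) :
    (ofPath hπ g).WinsFrom u R (0, g 0) := by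
  intro f mv hf h0 i ε hε
  obtain ⟨K, hK⟩ := hu i ε hε
  have key : ∀ t, (f t).2 = g (f t).1 ∧ (ofPath hπ g).total (u i) ε f mv t =
      ∑ t ∈ Finset.range (f t).1, (u i (π (g (t + 1))) + ε) := by
    intro t
    induction t with
    | zero => rw [h0]; simp [total]
    | succ t ih =>
      have hs : (ofPath hπ g).total (u i) ε f mv (t + 1) =
        (ofPath hπ g).total (u i) ε f mv t +
          if mv t = true then u i (π (f (t + 1)).2) + ε else 0 := Finset.sum_range_succ _ _
      rw [hs, ih.2]
      cases hm : mv t with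
      | false => rw [(hf t).2 hm]; simp [ih.1]
      | true =>
        obtain ⟨x, hx, he⟩ := (hf t).1 hm
        have hx' : x = π (g ((f t).1 + 1)) := hg _ x (by rw [← ih.1]; exact hx)
        have he' : f (t + 1) = ((f t).1 + 1, g ((f t).1 + 1)) := by
          rw [he]; simp [ofPath, hx']
        rw [he']
        simp [Finset.sum_range_succ]
  exact ⟨K, fun T => by rw [(key T).2]; exact hK _⟩

/-- If every positional strategy of the opponent can be beaten, then there is a single plan
which beats all strategies of the opponent. -/
theorem exists_winsFrom [Finite V] (hπ : Function.Surjective π) (u : I → S → ℝ) (v : V)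
    (R : V → Finset S) (hne : ∀ q, (R q).Nonempty)
    (H : ∀ τ : V → S, (∀ q, τ q ∈ R q) → ∃ g : ℕ → V, g 0 = v ∧
      (∀ t, π (g (t + 1)) = τ (g t)) ∧
      ∀ i, ∀ ε > 0, ∃ K : ℝ, ∀ T, -K ≤ ∑ t ∈ Finset.range T, (u i (π (g (t + 1))) + ε)) :
    ∃ (P : Plan π) (p : P.Pos), P.lab p = v ∧ P.WinsFrom u R p := by
  classical
  have := Fintype.ofFinite V
  induction hn : ∑ q, (R q).card using Nat.strong_induction_on generalizing R with
  | _ n ih =>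
  by_cases hbig : ∃ q, 1 < (R q).card
  · obtain ⟨q, hq⟩ := hbig
    obtain ⟨x₀, hx₀⟩ := hne q
    have restrict : ∀ E ⊆ R q, E.Nonempty → E.card < (R q).card →
        ∃ (P : Plan π) (p : P.Pos), P.lab p = v ∧
          P.WinsFrom u (Function.update R q E) p := by
      intro E hE hE0 hcard
      have hsub : ∀ y, Function.update R q E y ⊆ R y := by
        intro y
        by_cases hy : y = q
        · subst hy; simpa using hE
        · simp [hy]
      refine ih _ ?_ (Function.update R q E) (fun y => ?_)
        (fun τ hτ => H τ fun y => hsub y (hτ y)) rfl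
      · rw [← hn]
        exact Finset.sum_lt_sum (fun y _ => Finset.card_le_card (hsub y))
          ⟨q, Finset.mem_univ q, by simpa using hcard⟩
      · by_cases hy : y = q
        · subst hy; simpa using hE0
        · simpa [hy] using hne y
    obtain ⟨P₁, p₁, hl₁, hw₁⟩ := restrict {x₀} (by simpa using hx₀) (by simp) (by simpa using hq)
    have hc : ((R q).erase x₀).card = (R q).card - 1 := Finset.card_erase_of_mem hx₀
    obtain ⟨P₂, p₂, hl₂, hw₂⟩ := restrict ((R q).erase x₀) (Finset.erase_subset _ _)
      (Finset.card_pos.1 (by omega)) (by omega)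
    by_cases hwin : ∃ p, P₂.WinsFrom u (Function.update R q ((R q).erase x₀)) p ∧ P₂.lab p = q
    · obtain ⟨p, hp, hpq⟩ := hwin
      exact ⟨merge P₁ P₂ q x₀, (p₁, p, true), by simpa [merge] using hl₁, hw₁.merge hp hpq⟩
    · exact ⟨P₂, p₂, hl₂, hw₂.of_avoids fun p hp hpq => hwin ⟨p, hp, hpq⟩⟩
  · push Not at hbig
    choose τ hτ using hne
    obtain ⟨g, hg0, hg, hu⟩ := H τ hτ
    exact ⟨ofPath hπ g, (0, g 0), hg0, winsFrom_ofPath hπ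
      (fun t x hx => by rw [hg t]; exact Finset.card_le_one.1 (hbig _) x hx _ (hτ _)) hu⟩

end Plan

theorem nonneg_mean_shift (g : ℕ → ℝ) :
    (∀ ε > 0, ∃ K : ℝ, ∀ T, -K ≤ ∑ t ∈ Finset.range T, (g (t + 1) + ε)) ↔
      ∀ ε > 0, ∃ K : ℝ, ∀ T, -K ≤ ∑ t ∈ Finset.range T, (g t + ε) := by
  constructor <;> intro h ε hε <;> obtain ⟨K, hK⟩ := h ε hε
  · refine ⟨max 0 (K - (g 0 + ε)), fun T => ?_⟩
    cases T with
    | zero => simp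
    | succ T =>
      rw [Finset.sum_range_succ']
      linarith [hK T, le_max_right 0 (K - (g 0 + ε))]
  · refine ⟨K + (g 0 + ε), fun T => ?_⟩
    have := hK (T + 1)
    rw [Finset.sum_range_succ'] at this
    linarith

theorem le_meanPayoff_iff {β : ℕ → ℝ} {B : ℝ} (hB : ∀ t, |β t| ≤ B) (z : ℝ) :
    z ≤ meanPayoff β ↔
      ∀ ε > 0, ∃ K : ℝ, ∀ T, -K ≤ ∑ t ∈ Finset.range T, (β t - z + ε) := by
  have hB0 : 0 ≤ B := (abs_nonneg _).trans (hB 0)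
  have habs : ∀ n : ℕ, |(∑ t ∈ Finset.range n, β t) / (n : ℝ)| ≤ B := by
    intro n
    rw [abs_div, Nat.abs_cast]
    refine div_le_of_le_mul₀ (Nat.cast_nonneg n) hB0 ?_
    refine (Finset.abs_sum_le_sum_abs _ _).trans ?_
    refine (Finset.sum_le_sum fun t _ => hB t).trans ?_
    simp [mul_comm]
  have hsum : ∀ (ε : ℝ) (T : ℕ), ∑ t ∈ Finset.range T, (β t - z + ε) =
      ∑ t ∈ Finset.range T, β t - T * (z - ε) := by
    intro ε T
    simp only [Finset.sum_add_distrib, Finset.sum_sub_distrib, Finset.sum_const,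
      Finset.card_range, nsmul_eq_mul]
    ring
  have hge : Filter.IsBoundedUnder (· ≥ ·) Filter.atTop
      fun n : ℕ => (∑ t ∈ Finset.range n, β t) / (n : ℝ) :=
    Filter.isBoundedUnder_of ⟨-B, fun n => (abs_le.1 (habs n)).1⟩
  have hle : Filter.IsBoundedUnder (· ≤ ·) Filter.atTop
      fun n : ℕ => (∑ t ∈ Finset.range n, β t) / (n : ℝ) :=
    Filter.isBoundedUnder_of ⟨B, fun n => (abs_le.1 (habs n)).2⟩
  constructor
  · intro h ε hε
    have hev := Filter.eventually_lt_of_lt_liminf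
      (show z - ε < meanPayoff β by linarith) hge
    obtain ⟨N, hN⟩ := Filter.eventually_atTop.1 hev
    refine ⟨∑ t ∈ Finset.range (N + 1), |β t - z + ε|, fun T => ?_⟩
    rcases le_or_gt (N + 1) T with hT | hT
    · have h1 := hN T (by omega)
      have hT0 : (0 : ℝ) < T := by exact_mod_cast (show 0 < T by omega)
      rw [lt_div_iff₀ hT0] at h1
      have h2 : 0 ≤ ∑ t ∈ Finset.range (N + 1), |β t - z + ε| :=
        Finset.sum_nonneg fun t _ => abs_nonneg _
      rw [hsum]
      linarith
    · have h1 := (neg_abs_le (∑ t ∈ Finset.range T, (β t - z + ε)))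
      have h2 := Finset.abs_sum_le_sum_abs (fun t => β t - z + ε) (Finset.range T)
      have h3 : ∑ t ∈ Finset.range T, |β t - z + ε| ≤
          ∑ t ∈ Finset.range (N + 1), |β t - z + ε| :=
        Finset.sum_le_sum_of_subset_of_nonneg (Finset.range_mono (by omega))
          fun t _ _ => abs_nonneg _
      linarith
  · intro h
    refine le_of_forall_pos_sub_le fun ε hε => ?_
    obtain ⟨K, hK⟩ := h (ε / 2) (by linarith)
    refine Filter.le_liminf_of_le hle.isCoboundedUnder_ge ?_
    obtain ⟨N, hN⟩ := exists_nat_gt (K / (ε / 2))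
    filter_upwards [Filter.eventually_ge_atTop (N + 1)] with n hn
    have hn0 : (0 : ℝ) < n := by exact_mod_cast (show 0 < n by omega)
    have hNn : (N : ℝ) ≤ n := by exact_mod_cast (show N ≤ n by omega)
    rw [le_div_iff₀ hn0]
    have h1 := hK n
    rw [hsum] at h1
    rw [div_lt_iff₀ (by linarith)] at hN
    nlinarith

namespace CGS

variable {Ag St : Type} {Ac : Ag → Type} (M : CGS Ag St Ac) (σ : Profile St Ac)

theorem run_succ (t : ℕ) :
    M.run σ (t + 1) = M.tr (M.run σ t) fun i => σ i (M.histRun σ t).1 := rfl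

theorem histRun_succ (t : ℕ) :
    (M.histRun σ (t + 1)).1 = (M.histRun σ t).1 ++ [M.run σ (t + 1)] := rfl

theorem histRun_ne_nil (t : ℕ) : (M.histRun σ t).1 ≠ [] := by
  cases t <;> simp [histRun]

theorem histRun_getLastD (t : ℕ) (s : St) : (M.histRun σ t).1.getLastD s = M.run σ t := by
  cases t <;> simp [histRun, run, List.getLastD_eq_getLast?]

theorem histRun_length (t : ℕ) : (M.histRun σ t).1.length = t + 1 := by
  induction t with
  | zero => rfl
  | succ t ih => rw [histRun_succ, List.length_append, ih]; rfl

theorem IsRun.exists_profile {M : CGS Ag St Ac} {ρ : ℕ → St} (hρ : M.IsRun ρ) :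
    ∃ σ : Profile St Ac, ∀ t, M.run σ t = ρ t := by
  choose a ha using hρ.2
  refine ⟨fun i h => a (h.length - 1) i, fun t => ?_⟩
  induction t with
  | zero => exact hρ.1.symm
  | succ t ih => rw [run_succ, ih, ha t, histRun_length]; rfl

end CGS

namespace MPGame

variable {Ag St : Type} {Ac : Ag → Type}

theorem le_pay_iff [Finite St] (G : MPGame Ag St Ac) (i : Ag) (ρ : ℕ → St) (z : ℝ) :
    z ≤ G.pay i ρ ↔ ∀ ε > 0, ∃ K : ℝ, ∀ T,
      -K ≤ ∑ t ∈ Finset.range T, ((G.w i (ρ (t + 1)) : ℝ) - z + ε) := by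
  obtain ⟨B, hB⟩ := (Set.finite_range fun s => |(G.w i s : ℝ)|).bddAbove
  rw [nonneg_mean_shift fun t => (G.w i (ρ t) : ℝ) - z]
  exact le_meanPayoff_iff (fun t => hB ⟨ρ t, rfl⟩) z

open Classical in
/-- The possible successors of a state once the coalition `C` has fixed its joint action. -/
noncomputable def successors [Fintype St] (G : MPGame Ag St Ac) (C : Set Ag)
    (q : St × (∀ i : C, Ac i)) : Finset St :=
  {x | ∃ b : ∀ i, Ac i, (∀ i : C, b i = q.2 i) ∧ G.M.tr q.1 b = x}

theorem mem_successors [Fintype St] {G : MPGame Ag St Ac} {C : Set Ag}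
    {q : St × (∀ i : C, Ac i)} {x : St} :
    x ∈ G.successors C q ↔ ∃ b : ∀ i, Ac i, (∀ i : C, b i = q.2 i) ∧ G.M.tr q.1 b = x := by
  simp [successors]

/-- The complement of `C` can enforce any positional choice of successors. -/
theorem exists_counter_strategy [Fintype St] (G : MPGame Ag St Ac) (C : Set Ag)
    (σC : ∀ i ∈ C, Strategy St (Ac i)) (τ : St × (∀ i : C, Ac i) → St)
    (hτ : ∀ q, τ q ∈ G.successors C q) :
    ∃ σN : ∀ i ∉ C, Strategy St (Ac i), ∀ t,
      G.M.run (combine C σC σN) (t + 1) = τ (G.M.run (combine C σC σN) t,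
        fun i => σC i i.2 (G.M.histRun (combine C σC σN) t).1) := by
  choose b hb hbτ using fun q => mem_successors.1 (hτ q)
  refine ⟨fun i _ h => b (h.getLastD G.M.init, fun j => σC j j.2 h) i, fun t => ?_⟩
  rw [CGS.run_succ, ← hbτ]
  dsimp only
  congr 1
  funext i
  by_cases hi : i ∈ C
  · rw [hb _ ⟨i, hi⟩]
    simp [combine, hi]
  · simp only [combine, hi, dif_neg, not_false_eq_true, CGS.histRun_getLastD]

/-- A plan which wins against all successors yields a joint strategy of the coalition. -/
theorem isLowerBound_of_winsFrom [Fintype St] (G : MPGame Ag St Ac) (C : Set Ag) (z : Ag → ℚ)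
    (P : Plan (Prod.fst : St × (∀ i : C, Ac i) → St)) (p : P.Pos)
    (hp : (P.lab p).1 = G.M.init)
    (hw : P.WinsFrom (fun (i : C) s => (G.w i s : ℝ) - z i) (G.successors C) p) :
    G.IsLowerBound C z := by
  refine ⟨fun i hi h => (P.lab (h.tail.foldl P.next p)).2 ⟨i, hi⟩, fun σN i hi => ?_⟩
  set σ := combine C (fun i hi h => (P.lab (h.tail.foldl P.next p)).2 ⟨i, hi⟩) σN with hσ
  set f : ℕ → P.Pos := fun t => (G.M.histRun σ t).1.tail.foldl P.next p with hf
  have hnext : ∀ t, f (t + 1) = P.next (f t) (G.M.run σ (t + 1)) := by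
    intro t
    simp only [hf]
    rw [CGS.histRun_succ, List.tail_append_of_ne_nil (CGS.histRun_ne_nil _ _ _),
      List.foldl_append]
    rfl
  have hlab : ∀ t, (P.lab (f t)).1 = G.M.run σ t := by
    intro t
    cases t with
    | zero => exact hp
    | succ t => rw [hnext]; exact P.proj _ _
  have hplay : P.IsPlay (G.successors C) f fun _ => true := by
    refine fun t => ⟨fun _ => ⟨_, mem_successors.2
      ⟨fun i => σ i (G.M.histRun σ t).1, fun j => ?_, ?_⟩, hnext t⟩, by simp⟩
    · simp [hσ, combine, hf]
    · rw [hlab, CGS.run_succ]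
  rw [le_pay_iff]
  intro ε hε
  obtain ⟨K, hK⟩ := hw f _ hplay rfl ⟨i, hi⟩ ε hε
  refine ⟨K, fun T => ?_⟩
  simpa [Plan.total, hlab] using hK T

/-- A joint strategy which strictly exceeds `v` on each play can be replaced by one which
exceeds `v` with a uniform margin. -/
theorem exists_isLowerBound_of_lt [Fintype Ag] [Fintype St] [∀ i, Fintype (Ac i)]
    [∀ i, Nonempty (Ac i)] (G : MPGame Ag St Ac) (C : Set Ag)
    (σC : ∀ i ∈ C, Strategy St (Ac i)) (v : Ag → ℝ)
    (h : ∀ σN : ∀ i ∉ C, Strategy St (Ac i), ∀ i ∈ C,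
      v i < G.pay i (G.M.run (combine C σC σN))) :
    ∃ z : Ag → ℚ, G.IsLowerBound C z ∧ ∀ i ∈ C, v i < z i := by
  classical
  have hne : ∀ q, (G.successors C q).Nonempty := fun q =>
    ⟨_, mem_successors.2 ⟨fun i => if hi : i ∈ C then q.2 ⟨i, hi⟩ else Classical.arbitrary _,
      fun i => by simp, rfl⟩⟩
  let Θ := {τ : St × (∀ i : C, Ac i) → St // ∀ q, τ q ∈ G.successors C q}
  have : Nonempty Θ := ⟨fun q => (hne q).choose, fun q => (hne q).choose_spec⟩
  choose σN hσN using fun τ : Θ => G.exists_counter_strategy C σC τ.1 τ.2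
  have hz : ∀ i, ∃ r : ℚ, i ∈ C →
      v i < r ∧ ∀ τ, (r : ℝ) ≤ G.pay i (G.M.run (combine C σC (σN τ))) := by
    intro i
    by_cases hi : i ∈ C
    · obtain ⟨τ₀, hτ₀⟩ := Finite.exists_min fun τ => G.pay i (G.M.run (combine C σC (σN τ)))
      obtain ⟨r, hr, hr'⟩ := exists_rat_btwn (h (σN τ₀) i hi)
      exact ⟨r, fun _ => ⟨hr, fun τ => hr'.le.trans (hτ₀ τ)⟩⟩
    · exact ⟨0, fun hc => absurd hc hi⟩
  choose z hz using hz
  refine ⟨z, ?_, fun i hi => (hz i hi).1⟩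
  have hpath : ∀ τ : St × (∀ i : C, Ac i) → St, (∀ q, τ q ∈ G.successors C q) →
      ∃ g : ℕ → St × (∀ i : C, Ac i), g 0 = (G.M.init, fun i : C => σC i i.2 [G.M.init]) ∧
        (∀ t, (g (t + 1)).1 = τ (g t)) ∧ ∀ i : C, ∀ ε > 0, ∃ K : ℝ, ∀ T,
          -K ≤ ∑ t ∈ Finset.range T, ((G.w i (g (t + 1)).1 : ℝ) - z i + ε) := by
    intro τ hτ
    refine ⟨fun t => (G.M.run (combine C σC (σN ⟨τ, hτ⟩)) t,
      fun i : C => σC i i.2 (G.M.histRun (combine C σC (σN ⟨τ, hτ⟩)) t).1), rfl,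
      hσN ⟨τ, hτ⟩, fun i => ?_⟩
    exact (G.le_pay_iff i (G.M.run (combine C σC (σN ⟨τ, hτ⟩))) (z i)).1 ((hz i i.2).2 ⟨τ, hτ⟩)
  obtain ⟨P, p, hp, hw⟩ := Plan.exists_winsFrom Prod.fst_surjective
    (fun (i : C) s => (G.w i s : ℝ) - z i) _ (G.successors C) hne hpath
  exact G.isLowerBound_of_winsFrom C z P p (by rw [hp]) hw

end MPGame


/-- Let `G` be a mean-payoff game and `ρ` a run in `G`. There
exists a strategy profile `σ` in the core of `G` with `ρ = ρ(σ)` iff for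
every (nonempty) coalition `C ⊆ Ag` and every lower bound `z` for `C`, there
is some `i ∈ C` with `z i ≤ pay_i(ρ)`. -/
theorem core_run_iff_lower_bounds
    {Ag St : Type} {Ac : Ag → Type}
    [Fintype Ag] [Nonempty Ag] [Fintype St]
    [∀ i, Fintype (Ac i)] [∀ i, Nonempty (Ac i)]
    (G : MPGame Ag St Ac) (ρ : ℕ → St) (hρ : G.M.IsRun ρ) :
    (∃ σ : Profile St Ac, G.inCore σ ∧ ∀ t, G.M.run σ t = ρ t) ↔
      ∀ C : Set Ag, C.Nonempty → ∀ z : Ag → ℚ, G.IsLowerBound C z →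
        ∃ i ∈ C, (z i : ℝ) ≤ G.pay i ρ := by
  constructor
  · rintro ⟨σ, hσ, hrun⟩ C hC z ⟨σC, hz⟩
    by_contra! hlt
    refine hσ C σC ⟨hC, fun σN i hi => ?_⟩
    rw [funext hrun]
    exact (hlt i hi).trans_le (hz σN i hi)
  · intro h
    obtain ⟨σ, hσ⟩ := hρ.exists_profile
    refine ⟨σ, fun C σC hdev => ?_, hσ⟩
    rw [MPGame.BeneficialDeviation, funext hσ] at hdev
    obtain ⟨z, hz, hlt⟩ := G.exists_isLowerBound_of_lt C σC (fun i => G.pay i ρ) hdev.2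
    obtain ⟨i, hi, hle⟩ := h C hdev.1 z hz
    exact absurd hle (not_le.2 (hlt i hi))
end

section
/- Let G be a mean-payoff game and let (σ^j)_{j∈ℕ} be a sequence of strategy profiles such that for some player i, the sequence pay_i(ρ(σ^j)) converges to some x ∈ ℝ as j → ∞. Then there exists a strategy profile σ^x with pay_i(ρ(σ^x)) = x. -/
/-- If `f` is a run of the relation `E` ending (at time `L`) in the state where a run `g` starts,
following `f` for `L` steps and then `g` is again a run. -/
theorem splice_step {S : Type} {E : S → S → Prop} {f g : ℕ → S} {L : ℕ}
    (hf : ∀ t, E (f t) (f (t + 1))) (hg : ∀ t, E (g t) (g (t + 1))) (hL : f L = g 0) (t : ℕ) :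
    E (if t < L then f t else g (t - L)) (if t + 1 < L then f (t + 1) else g (t + 1 - L)) := by
  rcases lt_trichotomy (t + 1) L with h | h | h
  · simpa [h, (by omega : t < L)] using hf t
  · subst h
    simpa [← hL] using hf t
  · have h1 : ¬ t < L := by omega
    have h2 : ¬ t + 1 < L := by omega
    have h3 : t + 1 - L = t - L + 1 := by omega
    simpa [h1, h2, h3] using hg (t - L)

theorem sum_splice {S : Type} (u : S → ℝ) (f g : ℕ → S) (L m : ℕ) :
    ∑ t ∈ Finset.range (L + m), u (if t < L then f t else g (t - L)) =
      ∑ t ∈ Finset.range L, u (f t) + ∑ t ∈ Finset.range m, u (g t) := by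
  rw [Finset.sum_range_add]
  congr 1
  · refine Finset.sum_congr rfl fun t ht => ?_
    simp [Finset.mem_range.1 ht]
  · simp

theorem eventually_le_mul_natCast {ε : ℝ} (hε : 0 < ε) (c : ℝ) :
    ∀ᶠ m : ℕ in Filter.atTop, c ≤ ε * m :=
  (tendsto_natCast_atTop_atTop.const_mul_atTop hε).eventually_ge_atTop c

/-- One round of the splicing construction: prolong a run that is at `v` at time `L` by a
sufficiently long piece of a recurrent run `P` with deviation rate `ε`, ending again at `v`. -/
theorem exists_splice_extension {S : Type} {E : S → S → Prop} {u : S → ℝ} {v : S}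
    {P : ℕ → S} {ε B : ℝ} (B' : ℝ) (hε : 0 < ε)
    (hP : ∀ t, E (P t) (P (t + 1))) (hP0 : P 0 = v) (hPv : ∃ᶠ m in Filter.atTop, P m = v)
    (hlow : ∀ m : ℕ, -(ε * m) - B ≤ ∑ t ∈ Finset.range m, u (P t))
    (hup : ∃ᶠ m : ℕ in Filter.atTop, ∑ t ∈ Finset.range m, u (P t) ≤ ε * m + B)
    {f : ℕ → S} {L : ℕ} (hf : ∀ t, E (f t) (f (t + 1))) (hL : f L = v) :
    ∃ (g : ℕ → S) (L' : ℕ), (∀ t, E (g t) (g (t + 1))) ∧ g L' = v ∧ L < L' ∧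
      (∀ t ≤ L, g t = f t) ∧
      (∀ m : ℕ, ∑ t ∈ Finset.range L, u (f t) - ε * m - B ≤
        ∑ t ∈ Finset.range (L + m), u (g t)) ∧
      (∃ n, L ≤ n ∧ n ≤ L' ∧ ∑ t ∈ Finset.range n, u (g t) ≤ 2 * ε * n) ∧
      -(2 * ε * L') ≤ ∑ t ∈ Finset.range L', u (g t) - B' := by
  set d := ∑ t ∈ Finset.range L, u (f t) with hd
  have hL0 : 0 ≤ ε * (L : ℝ) := by positivity
  obtain ⟨a, ha, ha'⟩ := (hup.and_eventually (eventually_le_mul_natCast hε (d + B))).exists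
  obtain ⟨m, hm, hm', ham⟩ := (hPv.and_eventually
    ((eventually_le_mul_natCast hε (B + B' - d)).and (Filter.eventually_ge_atTop (a + 1)))).exists
  have hs := sum_splice u f P L
  refine ⟨fun t => if t < L then f t else P (t - L), L + m, splice_step hf hP (hL.trans hP0.symm),
    by simpa using hm, by omega, fun t ht => ?_, fun k => ?_,
    ⟨L + a, by omega, by omega, ?_⟩, ?_⟩
  · rcases ht.lt_or_eq with h | rfl
    · simp [h]
    · simp [hP0, hL]
  · have := hlow k
    simp only [hs]
    linarith
  · simp only [hs]
    push_cast
    linarith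
  · have := hlow m
    simp only [hs]
    push_cast
    linarith

/-- If a state `v` is the start of recurrent runs whose sums of `u` have arbitrarily small
deviation rates, then any run leading to `v` can be prolonged to a run on which the averages
of `u` have limit inferior `0`. -/
theorem exists_run_of_recurrent_runs {S : Type} {E : S → S → Prop} {u : S → ℝ} {v : S}
    (H : ∀ ε > 0, ∃ (P : ℕ → S) (B : ℝ), (∀ t, E (P t) (P (t + 1))) ∧ P 0 = v ∧
      (∃ᶠ m in Filter.atTop, P m = v) ∧
      (∀ m : ℕ, -(ε * m) - B ≤ ∑ t ∈ Finset.range m, u (P t)) ∧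
      ∃ᶠ m : ℕ in Filter.atTop, ∑ t ∈ Finset.range m, u (P t) ≤ ε * m + B)
    {f₀ : ℕ → S} {L₀ : ℕ} (hf₀ : ∀ t, E (f₀ t) (f₀ (t + 1))) (hL₀ : f₀ L₀ = v) :
    ∃ ρ : ℕ → S, ρ 0 = f₀ 0 ∧ (∀ t, E (ρ t) (ρ (t + 1))) ∧ ∀ ε > 0,
      (∀ᶠ n : ℕ in Filter.atTop, -(ε * n) ≤ ∑ t ∈ Finset.range n, u (ρ t)) ∧
      ∃ᶠ n : ℕ in Filter.atTop, ∑ t ∈ Finset.range n, u (ρ t) ≤ ε * n := by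
  have hε : ∀ k : ℕ, (0 : ℝ) < 1 / ((k : ℝ) + 1) := fun k => Nat.one_div_pos_of_nat
  choose P B hP hP0 hPv hlow hup using fun k : ℕ => H _ (hε k)
  choose g ℓ hg hgv hlt hagree hglow hgup hend using
    fun (k : ℕ) (p : {p : (ℕ → S) × ℕ // (∀ t, E (p.1 t) (p.1 (t + 1))) ∧ p.1 p.2 = v}) =>
      exists_splice_extension (B (k + 1)) (hε k) (hP k) (hP0 k) (hPv k) (hlow k) (hup k)
        p.2.1 p.2.2
  let s : ℕ → {p : (ℕ → S) × ℕ // (∀ t, E (p.1 t) (p.1 (t + 1))) ∧ p.1 p.2 = v} :=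
    fun k => Nat.rec ⟨(f₀, L₀), hf₀, hL₀⟩ (fun k p => ⟨(g k p, ℓ k p), hg k p, hgv k p⟩) k
  let f : ℕ → ℕ → S := fun k => (s k).1.1
  let L : ℕ → ℕ := fun k => (s k).1.2
  have hmono : StrictMono L := strictMono_nat_of_lt_succ fun k => hlt k (s k)
  have hstep : ∀ k, ∀ t ≤ L k, f (k + 1) t = f k t := fun k => hagree k (s k)
  have hle : ∀ k k', k ≤ k' → ∀ t ≤ L k, f k' t = f k t := by
    intro k k' hk
    induction k', hk using Nat.le_induction with
    | base => intro t _; rfl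
    | succ k' hk ih =>
      intro t ht
      rw [hstep k' t (ht.trans (hmono.monotone hk)), ih t ht]
  let ρ : ℕ → S := fun t => f t t
  have hρ : ∀ k, ∀ t ≤ L k, ρ t = f k t := by
    intro k t ht
    rcases le_total k t with h | h
    · exact hle k t h t ht
    · exact (hle t k h t (hmono.id_le t)).symm
  have hsum : ∀ k, ∀ n ≤ L k,
      ∑ t ∈ Finset.range n, u (ρ t) = ∑ t ∈ Finset.range n, u (f k t) := by
    intro k n hn
    refine Finset.sum_congr rfl fun t ht => ?_
    rw [hρ k t ((Finset.mem_range.1 ht).le.trans hn)]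
  refine ⟨ρ, rfl, fun t => ?_, fun ε hε0 => ?_⟩
  · rw [hρ (t + 1) t ((Nat.le_succ t).trans (hmono.id_le _)), hρ (t + 1) (t + 1) (hmono.id_le _)]
    exact (s (t + 1)).2.1 t
  obtain ⟨K, hK⟩ := exists_nat_one_div_lt (half_pos hε0)
  have hsmall : ∀ k, K ≤ k → 2 * (1 / ((k : ℝ) + 1)) ≤ ε := fun k hk => by
    have := Nat.one_div_le_one_div (α := ℝ) hk
    linarith
  constructor
  · have key : ∀ k, K + 1 ≤ k → ∀ n, L (K + 1) ≤ n → n ≤ L k →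
        -(ε * n) ≤ ∑ t ∈ Finset.range n, u (ρ t) := by
      have aux : ∀ k, K ≤ k → ∀ n, L (k + 1) ≤ n → n ≤ L (k + 2) →
          -(ε * n) ≤ ∑ t ∈ Finset.range n, u (ρ t) := by
        intro k hk n h1 h2
        obtain ⟨m, rfl⟩ := Nat.exists_eq_add_of_le h1
        rw [hsum (k + 2) _ h2]
        have e1 := hglow (k + 1) (s (k + 1)) m
        have e2 := hend k (s k)
        have e3 := mul_le_mul_of_nonneg_right (hsmall k hk) (Nat.cast_nonneg (α := ℝ) (L (k + 1)))
        have e4 := mul_le_mul_of_nonneg_right (hsmall (k + 1) (by omega))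
          (Nat.cast_nonneg (α := ℝ) m)
        have e5 := mul_nonneg (hε (k + 1)).le (Nat.cast_nonneg (α := ℝ) m)
        change ∑ t ∈ Finset.range (L (k + 1)), u (f (k + 1) t) - _ - _ ≤
          ∑ t ∈ Finset.range (L (k + 1) + m), u (f (k + 2) t) at e1
        change -(2 * (1 / ((k : ℝ) + 1)) * (L (k + 1) : ℝ)) ≤
          ∑ t ∈ Finset.range (L (k + 1)), u (f (k + 1) t) - _ at e2
        rw [Nat.cast_add, mul_add]
        linarith
      intro k hk
      induction k, hk using Nat.le_induction with
      | base =>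
        intro n h1 h2
        exact aux K le_rfl n h1 (h2.trans (hmono (Nat.lt_succ_self (K + 1))).le)
      | succ k hk ih =>
        intro n h1 h2
        rcases le_total n (L k) with h | h
        · exact ih n h1 h
        · obtain ⟨k, rfl⟩ := Nat.exists_eq_add_of_le' (show 1 ≤ k by omega)
          exact aux k (by omega) n h h2
    filter_upwards [Filter.eventually_ge_atTop (L (K + 1))] with n hn
    exact key (max (K + 1) n) (le_max_left _ _) n hn
      ((hmono.id_le n).trans (hmono.monotone (le_max_right _ _)))
  · rw [Filter.frequently_atTop]
    intro N
    obtain ⟨n, h1, h2, h3⟩ := hgup (max K N) (s (max K N))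
    refine ⟨n, ((le_max_right K N).trans (hmono.id_le _)).trans h1, ?_⟩
    rw [hsum (max K N + 1) n h2]
    exact h3.trans (mul_le_mul_of_nonneg_right (hsmall _ (le_max_left _ _)) (Nat.cast_nonneg n))

theorem abs_average_le {β : ℕ → ℝ} {W : ℝ} (hβ : ∀ t, |β t| ≤ W) (n : ℕ) :
    |(∑ t ∈ Finset.range n, β t) / (n : ℝ)| ≤ W := by
  have hW : 0 ≤ W := (abs_nonneg _).trans (hβ 0)
  rw [abs_div, Nat.abs_cast]
  refine div_le_of_le_mul₀ (Nat.cast_nonneg n) hW ?_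
  calc |∑ t ∈ Finset.range n, β t| ≤ ∑ t ∈ Finset.range n, |β t| := Finset.abs_sum_le_sum_abs _ _
    _ ≤ ∑ _t ∈ Finset.range n, W := Finset.sum_le_sum fun t _ => hβ t
    _ = W * n := by simp [mul_comm]

theorem isBoundedUnder_ge_average {β : ℕ → ℝ} {W : ℝ} (hβ : ∀ t, |β t| ≤ W) :
    Filter.IsBoundedUnder (· ≥ ·) Filter.atTop
      (fun n : ℕ => (∑ t ∈ Finset.range n, β t) / (n : ℝ)) :=
  Filter.isBoundedUnder_of ⟨-W, fun n => (abs_le.1 (abs_average_le hβ n)).1⟩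

theorem isCoboundedUnder_ge_average {β : ℕ → ℝ} {W : ℝ} (hβ : ∀ t, |β t| ≤ W) :
    Filter.IsCoboundedUnder (· ≥ ·) Filter.atTop
      (fun n : ℕ => (∑ t ∈ Finset.range n, β t) / (n : ℝ)) :=
  (Filter.isBoundedUnder_of (r := (· ≤ ·))
    ⟨W, fun n => (abs_le.1 (abs_average_le hβ n)).2⟩).isCoboundedUnder_ge

theorem eventually_mul_le_sum_of_lt_meanPayoff {β : ℕ → ℝ} {W c : ℝ} (hβ : ∀ t, |β t| ≤ W)
    (hc : c < meanPayoff β) :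
    ∀ᶠ n : ℕ in Filter.atTop, c * n ≤ ∑ t ∈ Finset.range n, β t := by
  filter_upwards [Filter.eventually_lt_of_lt_liminf hc (isBoundedUnder_ge_average hβ),
    Filter.eventually_gt_atTop 0] with n hn hn0
  exact ((lt_div_iff₀ (Nat.cast_pos.2 hn0)).1 hn).le

theorem frequently_sum_le_mul_of_meanPayoff_lt {β : ℕ → ℝ} {W c : ℝ} (hβ : ∀ t, |β t| ≤ W)
    (hc : meanPayoff β < c) :
    ∃ᶠ n : ℕ in Filter.atTop, ∑ t ∈ Finset.range n, β t ≤ c * n := by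
  refine ((Filter.frequently_lt_of_liminf_lt (isCoboundedUnder_ge_average hβ) hc).and_eventually
    (Filter.eventually_gt_atTop 0)).mono fun n hn => ?_
  exact ((div_lt_iff₀ (Nat.cast_pos.2 hn.2)).1 hn.1).le

theorem meanPayoff_eq_of_forall_pos {β : ℕ → ℝ} {W x : ℝ} (hβ : ∀ t, |β t| ≤ W)
    (h : ∀ ε > 0, (∀ᶠ n : ℕ in Filter.atTop, (x - ε) * n ≤ ∑ t ∈ Finset.range n, β t) ∧
      ∃ᶠ n : ℕ in Filter.atTop, ∑ t ∈ Finset.range n, β t ≤ (x + ε) * n) :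
    meanPayoff β = x := by
  apply le_antisymm
  · refine le_of_forall_pos_le_add fun ε hε => ?_
    refine Filter.liminf_le_of_frequently_le (((h ε hε).2.and_eventually
      (Filter.eventually_gt_atTop 0)).mono fun n hn => ?_) (isBoundedUnder_ge_average hβ)
    exact (div_le_iff₀ (Nat.cast_pos.2 hn.2)).2 hn.1
  · refine le_of_forall_pos_le_add fun ε hε => sub_le_iff_le_add.1 ?_
    refine Filter.le_liminf_of_le (isCoboundedUnder_ge_average hβ) ?_
    filter_upwards [(h ε hε).1, Filter.eventually_gt_atTop 0] with n hn hn0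
    exact (le_div_iff₀ (Nat.cast_pos.2 hn0)).2 hn

/-- Every sequence of reals that is eventually nonnegative is bounded below. -/
theorem exists_neg_le_of_eventually_nonneg {φ : ℕ → ℝ} (h : ∀ᶠ n in Filter.atTop, 0 ≤ φ n) :
    ∃ B : ℝ, ∀ n, -B ≤ φ n := by
  obtain ⟨b, hb⟩ := (Filter.isBoundedUnder_of_eventually_ge h).bddBelow_range
  exact ⟨-b, fun n => by simpa using hb (Set.mem_range_self n)⟩

namespace CGS

variable {Ag St : Type} {Ac : Ag → Type}

theorem isRun_run (M : CGS Ag St Ac) (σ : Profile St Ac) : M.IsRun (M.run σ) :=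
  ⟨rfl, fun t => ⟨fun i => σ i (M.histRun σ t).1, rfl⟩⟩

theorem length_histRun (M : CGS Ag St Ac) (σ : Profile St Ac) (t : ℕ) :
    (M.histRun σ t).1.length = t + 1 := by
  induction t with
  | zero => rfl
  | succ t ih => simp [histRun, ih]

theorem IsRun.exists_run_eq {M : CGS Ag St Ac} {ρ : ℕ → St} (h : M.IsRun ρ) :
    ∃ σ : Profile St Ac, M.run σ = ρ := by
  choose a ha using h.2
  refine ⟨fun i l => a (l.length - 1) i, funext fun t => ?_⟩
  induction t with
  | zero => exact h.1.symm
  | succ t ih =>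
    rw [ha t, ← ih]
    simp [run, histRun, length_histRun]

end CGS

/-- If along a sequence of strategy profiles the payoffs of
player `i` converge to `x ∈ ℝ`, then some strategy profile gives player `i`
the payoff exactly `x`. -/
theorem payoff_limit_attained
    {Ag St : Type} {Ac : Ag → Type}
    [Fintype Ag] [Nonempty Ag] [Fintype St]
    [∀ i, Fintype (Ac i)] [∀ i, Nonempty (Ac i)]
    (G : MPGame Ag St Ac) (σs : ℕ → Profile St Ac) (i : Ag) (x : ℝ)
    (h : Filter.Tendsto (fun j => G.pay i (G.M.run (σs j)))
      Filter.atTop (nhds x)) :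
    ∃ σ : Profile St Ac, G.pay i (G.M.run σ) = x := by
  obtain ⟨W, hW⟩ : ∃ W : ℝ, ∀ s, |(G.w i s : ℝ)| ≤ W := by
    obtain ⟨W, hW⟩ := (Set.finite_range fun s => |(G.w i s : ℝ)|).bddAbove
    exact ⟨W, fun s => hW (Set.mem_range_self s)⟩
  have hrec : ∀ j, ∃ v, ∃ᶠ t in Filter.atTop, G.M.run (σs j) t = v := fun j => by
    obtain ⟨v, hv⟩ := Finite.exists_infinite_fiber (G.M.run (σs j))
    exact ⟨v, Nat.frequently_atTop_iff_infinite.2 (Set.infinite_coe_iff.1 hv)⟩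
  choose vs hvs using hrec
  obtain ⟨v, hv⟩ := Finite.exists_infinite_fiber vs
  have hv : ∃ᶠ j in Filter.atTop, vs j = v :=
    Nat.frequently_atTop_iff_infinite.2 (Set.infinite_coe_iff.1 hv)
  obtain ⟨j₀, hj₀⟩ := hv.exists
  obtain ⟨L₀, hL₀⟩ := (hvs j₀).exists
  have hrun : ∀ ε > 0, ∃ (P : ℕ → St) (B : ℝ), (∀ t, ∃ a, P (t + 1) = G.M.tr (P t) a) ∧
      P 0 = v ∧ (∃ᶠ m in Filter.atTop, P m = v) ∧
      (∀ m : ℕ, -(ε * m) - B ≤ ∑ t ∈ Finset.range m, ((G.w i (P t) : ℝ) - x)) ∧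
      ∃ᶠ m : ℕ in Filter.atTop,
        ∑ t ∈ Finset.range m, ((G.w i (P t) : ℝ) - x) ≤ ε * m + B := by
    intro ε hε
    obtain ⟨j, hj, hj1, hj2⟩ := (hv.and_eventually
      ((h.eventually_const_lt (sub_lt_self x hε)).and
        (h.eventually_lt_const (lt_add_of_pos_right x hε)))).exists
    set ρ := G.M.run (σs j) with hρ
    obtain ⟨L, hL⟩ := (hvs j).exists
    have hsum : ∀ m : ℕ, ∑ t ∈ Finset.range m, ((G.w i (ρ (L + t)) : ℝ) - x) =
        ∑ t ∈ Finset.range (L + m), (G.w i (ρ t) : ℝ) -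
          ∑ t ∈ Finset.range L, (G.w i (ρ t) : ℝ) - m * x := fun m => by
      rw [Finset.sum_range_add]
      simp
    have hlow := eventually_mul_le_sum_of_lt_meanPayoff (fun t => hW (ρ t)) hj1
    have hup := frequently_sum_le_mul_of_meanPayoff_lt (fun t => hW (ρ t)) hj2
    obtain ⟨B₁, hB₁⟩ := exists_neg_le_of_eventually_nonneg
      (hlow.mono fun n hn => sub_nonneg.2 hn)
    set d := ∑ t ∈ Finset.range L, (G.w i (ρ t) : ℝ) with hd
    have shift : ∀ {p : ℕ → Prop}, (∃ᶠ n in Filter.atTop, p n) →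
        ∃ᶠ m in Filter.atTop, p (L + m) := by
      intro p hp
      rw [Filter.frequently_atTop] at hp ⊢
      intro N
      obtain ⟨n, hn, hpn⟩ := hp (L + N)
      exact ⟨n - L, by omega, by rwa [Nat.add_sub_cancel' (by omega)]⟩
    refine ⟨fun t => ρ (L + t), max (B₁ + d - (x - ε) * L) ((x + ε) * L - d),
      fun t => (G.M.isRun_run _).2 (L + t), hL.trans hj, shift (hj ▸ hvs j), fun m => ?_, ?_⟩
    · have h1 := hB₁ (L + m)
      have h2 := le_max_left (B₁ + d - (x - ε) * L) ((x + ε) * L - d)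
      rw [hsum]
      push_cast at h1
      linarith
    · refine (shift hup).mono fun m hm => ?_
      have h2 := le_max_right (B₁ + d - (x - ε) * L) ((x + ε) * L - d)
      rw [hsum]
      push_cast at hm
      linarith
  obtain ⟨ρ, hρ0, hρ, hpay⟩ := exists_run_of_recurrent_runs
    (E := fun s s' => ∃ a, s' = G.M.tr s a) (u := fun s => (G.w i s : ℝ) - x) (v := v)
    (f₀ := G.M.run (σs j₀)) (L₀ := L₀) hrun (G.M.isRun_run _).2 (hL₀.trans hj₀)
  obtain ⟨σ, hσ⟩ := CGS.IsRun.exists_run_eq (M := G.M) (ρ := ρ)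
    ⟨hρ0.trans (G.M.isRun_run _).1, hρ⟩
  refine ⟨σ, hσ ▸ meanPayoff_eq_of_forall_pos (fun t => hW _) fun ε hε => ?_⟩
  obtain ⟨h1, h2⟩ := hpay ε hε
  simp only [Finset.sum_sub_distrib, Finset.sum_const, Finset.card_range, nsmul_eq_mul] at h1 h2
  exact ⟨h1.mono fun n hn => by linarith, h2.mono fun n hn => by linarith⟩
end
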